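/- arXiv:2104.00110 — 4 statements merged into one kernel-verified Lean document; each statement's English description precedes it below -/
import Mathlib

section
/- Let f be an expanding Lorenz map with critical point c and let g = (f^l, f^r) be a renormalization of f with renormalization interval [u,v]. Then the following are equivalent: (i) 0 ∈ F_g, 1 ∈ F_g, and f(x) ∈ F_g for every x ∈ F_g with x ≠ c; (ii) the forward orbit of u enters (u,v) and the forward orbit of v enters (u,v), i.e. there exist i, j ≥ 1 with f^i(u) ∈ (u,v) and f^j(v) ∈ (u,v) (until the first entry into (u,v) these orbits cannot pass through c, since c ∈ (u,v), so the iterates are unambiguous). -/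
open Set Filter Topology Function

/-- `f` is an expanding Lorenz map on `[a,b]` with critical point `c`:
continuous and strictly increasing on `[a,c)` and `(c,b]`, with
`lim_{x→c⁻} f(x) = b`, `lim_{x→c⁺} f(x) = a`, and differentiable with
derivative uniformly greater than `1` outside a finite set. -/
structure IsExpandingLorenzOn (f : ℝ → ℝ) (c a b : ℝ) : Prop where
  a_lt_c : a < c
  c_lt_b : c < b
  mapsTo : Set.MapsTo f (Set.Icc a b) (Set.Icc a b)
  mono_left : StrictMonoOn f (Set.Ico a c)
  mono_right : StrictMonoOn f (Set.Ioc c b)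
  cont_left : ContinuousOn f (Set.Ico a c)
  cont_right : ContinuousOn f (Set.Ioc c b)
  lim_left : Filter.Tendsto f (nhdsWithin c (Set.Iio c)) (nhds b)
  lim_right : Filter.Tendsto f (nhdsWithin c (Set.Ioi c)) (nhds a)
  expanding : ∃ F : Set ℝ, F.Finite ∧ ∃ lam : ℝ, 1 < lam ∧
    ∀ x ∈ Set.Icc a b \ F, ∃ d : ℝ, HasDerivWithinAt f d (Set.Icc a b) x ∧ lam ≤ d

/-- An expanding Lorenz map on `[0,1]` with critical point `c`. -/
def IsExpandingLorenz (f : ℝ → ℝ) (c : ℝ) : Prop := IsExpandingLorenzOn f c 0 1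

/-- A primary `n(k)`-cycle `z 0 < z 1 < ⋯ < z (n-k-1) < c < z (n-k) < ⋯ < z (n-1)`
for a Lorenz map `f` with critical point `c`. -/
structure IsPrimaryCycle (f : ℝ → ℝ) (c : ℝ) (n k : ℕ) (z : ℕ → ℝ) : Prop where
  k_pos : 0 < k
  k_lt_n : k < n
  coprime : Nat.Coprime n k
  mem : ∀ i < n, z i ∈ Set.Icc (0:ℝ) 1
  mono : ∀ i j : ℕ, i < j → j < n → z i < z j
  left_of_c : ∀ i < n - k, z i < c
  right_of_c : ∀ i : ℕ, n - k ≤ i → i < n → c < z i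
  step : ∀ i < n, f (z i) = z ((i + k) % n)
  le_f0 : z (k - 1) ≤ f 0
  f1_le : f 1 ≤ z k

/-- `g` is a renormalization `(f^l, f^r)` of the Lorenz map `f` on the
renormalization interval `[u,v]`: on `[u,c)` (resp. `(c,v]`) the map `g`
is given by `f^[l]` (resp. `f^[r]`), with values given by one-sided limits
at points where some earlier iterate hits `c`, and `g` is itself an
expanding Lorenz map on `[u,v]` with critical point `c`. -/
structure IsRenormalization (f : ℝ → ℝ) (c : ℝ) (l r : ℕ) (u v : ℝ) (g : ℝ → ℝ) : Prop where
  one_lt_l : 1 < l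
  one_lt_r : 1 < r
  u_nonneg : 0 ≤ u
  u_lt_c : u < c
  c_lt_v : c < v
  v_le_one : v ≤ 1
  proper : 0 < u ∨ v < 1
  eq_left : ∀ x ∈ Set.Ico u c, (∀ i < l, f^[i] x ≠ c) → g x = f^[l] x
  eq_right : ∀ x ∈ Set.Ioc c v, (∀ i < r, f^[i] x ≠ c) → g x = f^[r] x
  lim_left_pt : ∀ x ∈ Set.Ico u c,
    Filter.Tendsto (f^[l]) (nhdsWithin x (Set.Ioi x)) (nhds (g x))
  lim_right_pt : ∀ x ∈ Set.Ioc c v,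
    Filter.Tendsto (f^[r]) (nhdsWithin x (Set.Iio x)) (nhds (g x))
  lim_c_left : Filter.Tendsto (f^[l]) (nhdsWithin c (Set.Iio c)) (nhds v)
  lim_c_right : Filter.Tendsto (f^[r]) (nhdsWithin c (Set.Ioi c)) (nhds u)
  lorenz : IsExpandingLorenzOn g c u v

/-- The forward orbit of `x` enters the set `S` with a `c`-free prefix:
there is `n ≥ 0` with `f^[i] x ≠ c` for `0 ≤ i < n` and `f^[n] x ∈ S`. -/
def CFreeEnters (f : ℝ → ℝ) (c : ℝ) (S : Set ℝ) (x : ℝ) : Prop :=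
  ∃ n : ℕ, (∀ i < n, f^[i] x ≠ c) ∧ f^[n] x ∈ S

/-- `N(U) = min {n ≥ 0 : f^[n] z = c for some z ∈ U}`. -/
noncomputable def hitTime (f : ℝ → ℝ) (c : ℝ) (U : Set ℝ) : ℕ :=
  sInf {n : ℕ | ∃ z ∈ U, f^[n] z = c}

/-- `x ∈ [0,1]` is a `c`-free periodic point of `f` of (exact) period `p`. -/
def IsCFreePeriodic (f : ℝ → ℝ) (c x : ℝ) (p : ℕ) : Prop :=
  x ∈ Set.Icc (0:ℝ) 1 ∧ f^[p] x = x ∧ (∀ i : ℕ, 0 < i → i < p → f^[i] x ≠ x) ∧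
    ∀ i < p, f^[i] x ≠ c

/-- Topological transitivity of `f` as a map of `[0,1]`. -/
def LorenzTransitive (f : ℝ → ℝ) : Prop :=
  ∀ U V : Set ℝ, IsOpen U → IsOpen V →
    (U ∩ Set.Icc 0 1).Nonempty → (V ∩ Set.Icc 0 1).Nonempty →
    ∃ n : ℕ, (f^[n] '' (U ∩ Set.Icc 0 1) ∩ (V ∩ Set.Icc 0 1)).Nonempty

/-- `f` is locally eventually onto: every nonempty (relatively) open subset of `[0,1]`
contains open intervals mapped homeomorphically onto `(0,c)` and onto `(c,1)`
by suitable iterates of `f`. -/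
def LocallyEventuallyOnto (f : ℝ → ℝ) (c : ℝ) : Prop :=
  ∀ U : Set ℝ, IsOpen U → (U ∩ Set.Icc 0 1).Nonempty →
    (∃ a b : ℝ, a < b ∧ Set.Ioo a b ⊆ U ∩ Set.Icc 0 1 ∧ ∃ n : ℕ,
      ContinuousOn (f^[n]) (Set.Ioo a b) ∧ Set.InjOn (f^[n]) (Set.Ioo a b) ∧
        f^[n] '' Set.Ioo a b = Set.Ioo 0 c) ∧
    (∃ a b : ℝ, a < b ∧ Set.Ioo a b ⊆ U ∩ Set.Icc 0 1 ∧ ∃ n : ℕ,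
      ContinuousOn (f^[n]) (Set.Ioo a b) ∧ Set.InjOn (f^[n]) (Set.Ioo a b) ∧
        f^[n] '' Set.Ioo a b = Set.Ioo c 1)

/-- The generalized backward orbit of `x`: points joined to `x` by a chain
following `f`, where at the critical point `c` the chain may continue with
either `0` or `1`. -/
def GenBackwardOrbit (f : ℝ → ℝ) (c x : ℝ) : Set ℝ :=
  {y | y ∈ Set.Icc (0:ℝ) 1 ∧ ∃ (k : ℕ) (w : ℕ → ℝ), w 0 = y ∧ w k = x ∧
    ∀ i < k, (w i ≠ c → w (i + 1) = f (w i)) ∧ (w i = c → w (i + 1) = 0 ∨ w (i + 1) = 1)}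

namespace IsExpandingLorenzOn

variable {f : ℝ → ℝ} {a b c x : ℝ}

theorem tendsto_nhdsGT_critical (h : IsExpandingLorenzOn f c a b) :
    Tendsto f (𝓝[>] c) (𝓝[>] a) := by
  refine tendsto_nhdsWithin_iff.2 ⟨h.lim_right, ?_⟩
  filter_upwards [Ioo_mem_nhdsGT h.c_lt_b] with y hy
  obtain ⟨z, hcz, hzy⟩ := exists_between hy.1
  have := h.a_lt_c
  exact (h.mapsTo (x := z) ⟨by linarith, by linarith [hy.2]⟩).1.trans_lt
    (h.mono_right ⟨hcz, by linarith [hy.2]⟩ ⟨hy.1, hy.2.le⟩ hzy)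

theorem tendsto_nhdsLT_critical (h : IsExpandingLorenzOn f c a b) :
    Tendsto f (𝓝[<] c) (𝓝[<] b) := by
  refine tendsto_nhdsWithin_iff.2 ⟨h.lim_left, ?_⟩
  filter_upwards [Ioo_mem_nhdsLT h.a_lt_c] with y hy
  obtain ⟨z, hyz, hzc⟩ := exists_between hy.2
  have := h.c_lt_b
  exact (h.mono_left ⟨hy.1.le, hy.2⟩ ⟨by linarith [hy.1], hzc⟩ hyz).trans_le
    (h.mapsTo (x := z) ⟨by linarith [hy.1], by linarith⟩).2

/-- On `[a,b)` away from the critical point, `f` preserves right-sided approach. -/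
theorem tendsto_nhdsGT (h : IsExpandingLorenzOn f c a b) (hx : x ∈ Ico a b) (hxc : x ≠ c) :
    f x ∈ Ico a b ∧ Tendsto f (𝓝[>] x) (𝓝[>] (f x)) := by
  have hac := h.a_lt_c
  have hcb := h.c_lt_b
  obtain ⟨d, s, hxd, hds, hxs, hs, hmono, hcont⟩ : ∃ (d : ℝ) (s : Set ℝ), x < d ∧ Ioo x d ⊆ s ∧
      x ∈ s ∧ s ⊆ Icc a b ∧ StrictMonoOn f s ∧ ContinuousOn f s := by
    rcases lt_or_gt_of_ne hxc with hlt | hlt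
    · exact ⟨c, Ico a c, hlt, fun y hy => ⟨hx.1.trans hy.1.le, hy.2⟩, ⟨hx.1, hlt⟩,
        fun y hy => ⟨hy.1, by linarith [hy.2]⟩, h.mono_left, h.cont_left⟩
    · exact ⟨b, Ioc c b, hx.2, fun y hy => ⟨hlt.trans hy.1, hy.2.le⟩, ⟨hlt, hx.2.le⟩,
        fun y hy => ⟨by linarith [hy.1], hy.2⟩, h.mono_right, h.cont_right⟩
  obtain ⟨y, hy⟩ := exists_between hxd
  have hnhds : s ∈ 𝓝[>] x := mem_of_superset (Ioo_mem_nhdsGT hxd) hds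
  refine ⟨⟨(h.mapsTo (hs hxs)).1,
    (hmono hxs (hds hy) hy.1).trans_le (h.mapsTo (hs (hds hy))).2⟩, ?_⟩
  refine tendsto_nhdsWithin_iff.2 ⟨(hcont x hxs).mono_left (nhdsWithin_le_iff.2 hnhds), ?_⟩
  filter_upwards [hnhds, self_mem_nhdsWithin] with z hz hxz using hmono hxs hz hxz

/-- On `(a,b]` away from the critical point, `f` preserves left-sided approach. -/
theorem tendsto_nhdsLT (h : IsExpandingLorenzOn f c a b) (hx : x ∈ Ioc a b) (hxc : x ≠ c) :
    f x ∈ Ioc a b ∧ Tendsto f (𝓝[<] x) (𝓝[<] (f x)) := by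
  have hac := h.a_lt_c
  have hcb := h.c_lt_b
  obtain ⟨d, s, hdx, hds, hxs, hs, hmono, hcont⟩ : ∃ (d : ℝ) (s : Set ℝ), d < x ∧ Ioo d x ⊆ s ∧
      x ∈ s ∧ s ⊆ Icc a b ∧ StrictMonoOn f s ∧ ContinuousOn f s := by
    rcases lt_or_gt_of_ne hxc with hlt | hlt
    · exact ⟨a, Ico a c, hx.1, fun y hy => ⟨hy.1.le, hy.2.trans hlt⟩, ⟨hx.1.le, hlt⟩,
        fun y hy => ⟨hy.1, by linarith [hy.2]⟩, h.mono_left, h.cont_left⟩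
    · exact ⟨c, Ioc c b, hlt, fun y hy => ⟨hy.1, hy.2.le.trans hx.2⟩, ⟨hlt, hx.2⟩,
        fun y hy => ⟨by linarith [hy.1], hy.2⟩, h.mono_right, h.cont_right⟩
  obtain ⟨y, hy⟩ := exists_between hdx
  have hnhds : s ∈ 𝓝[<] x := mem_of_superset (Ioo_mem_nhdsLT hdx) hds
  refine ⟨⟨(h.mapsTo (hs (hds hy))).1.trans_lt (hmono (hds hy) hxs hy.2),
    (h.mapsTo (hs hxs)).2⟩, ?_⟩
  refine tendsto_nhdsWithin_iff.2 ⟨(hcont x hxs).mono_left (nhdsWithin_le_iff.2 hnhds), ?_⟩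
  filter_upwards [hnhds, self_mem_nhdsWithin] with z hz hzx using hmono hz hxs hzx

/-- One-sided limits at `c⁺` of iterates of `f` lie on the orbit of `a` before it meets `c`. -/
theorem exists_tendsto_iterate_nhdsGT (h : IsExpandingLorenzOn f c a b) (n : ℕ) :
    ∃ m : ℕ, (∀ i < m, f^[i] a ≠ c) ∧ f^[m] a ∈ Ico a b ∧
      Tendsto f^[n + 1] (𝓝[>] c) (𝓝[>] (f^[m] a)) := by
  induction n with
  | zero =>
    exact ⟨0, by simp, ⟨le_rfl, h.a_lt_c.trans h.c_lt_b⟩, h.tendsto_nhdsGT_critical⟩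
  | succ n ih =>
    obtain ⟨m, hm, hmem, hlim⟩ := ih
    rw [iterate_succ']
    by_cases hc : f^[m] a = c
    · rw [hc] at hlim
      exact ⟨0, by simp, ⟨le_rfl, h.a_lt_c.trans h.c_lt_b⟩, h.tendsto_nhdsGT_critical.comp hlim⟩
    · obtain ⟨hmem', hlim'⟩ := h.tendsto_nhdsGT hmem hc
      refine ⟨m + 1, fun i hi => ?_, ?_⟩
      · rcases Nat.lt_succ_iff_lt_or_eq.1 hi with hi | rfl
        exacts [hm i hi, hc]
      · rw [iterate_succ_apply']
        exact ⟨hmem', hlim'.comp hlim⟩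

/-- One-sided limits at `c⁻` of iterates of `f` lie on the orbit of `b` before it meets `c`. -/
theorem exists_tendsto_iterate_nhdsLT (h : IsExpandingLorenzOn f c a b) (n : ℕ) :
    ∃ m : ℕ, (∀ i < m, f^[i] b ≠ c) ∧ f^[m] b ∈ Ioc a b ∧
      Tendsto f^[n + 1] (𝓝[<] c) (𝓝[<] (f^[m] b)) := by
  induction n with
  | zero =>
    exact ⟨0, by simp, ⟨h.a_lt_c.trans h.c_lt_b, le_rfl⟩, h.tendsto_nhdsLT_critical⟩
  | succ n ih =>
    obtain ⟨m, hm, hmem, hlim⟩ := ih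
    rw [iterate_succ']
    by_cases hc : f^[m] b = c
    · rw [hc] at hlim
      exact ⟨0, by simp, ⟨h.a_lt_c.trans h.c_lt_b, le_rfl⟩, h.tendsto_nhdsLT_critical.comp hlim⟩
    · obtain ⟨hmem', hlim'⟩ := h.tendsto_nhdsLT hmem hc
      refine ⟨m + 1, fun i hi => ?_, ?_⟩
      · rcases Nat.lt_succ_iff_lt_or_eq.1 hi with hi | rfl
        exacts [hm i hi, hc]
      · rw [iterate_succ_apply']
        exact ⟨hmem', hlim'.comp hlim⟩

end IsExpandingLorenzOn

namespace IsRenormalization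

variable {f g : ℝ → ℝ} {c u v x : ℝ} {l r : ℕ}

theorem exists_iterate_zero_eq (hg : IsRenormalization f c l r u v g)
    (hf : IsExpandingLorenz f c) : ∃ m : ℕ, (∀ i < m, f^[i] 0 ≠ c) ∧ f^[m] 0 = u := by
  obtain ⟨m, hm, -, hlim⟩ := hf.exists_tendsto_iterate_nhdsGT (r - 1)
  rw [Nat.sub_add_cancel hg.one_lt_r.le] at hlim
  exact ⟨m, hm, tendsto_nhds_unique (hlim.mono_right nhdsWithin_le_nhds) hg.lim_c_right⟩

theorem exists_iterate_one_eq (hg : IsRenormalization f c l r u v g)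
    (hf : IsExpandingLorenz f c) : ∃ m : ℕ, (∀ i < m, f^[i] 1 ≠ c) ∧ f^[m] 1 = v := by
  obtain ⟨m, hm, -, hlim⟩ := hf.exists_tendsto_iterate_nhdsLT (l - 1)
  rw [Nat.sub_add_cancel hg.one_lt_l.le] at hlim
  exact ⟨m, hm, tendsto_nhds_unique (hlim.mono_right nhdsWithin_le_nhds) hg.lim_c_left⟩

/-- The orbit of a point of `(u,v)` other than `c` returns to `[u,v]`. -/
theorem exists_iterate_mem_Icc (hg : IsRenormalization f c l r u v g)
    (hx : x ∈ Ioo u v) (hxc : x ≠ c) : ∃ n : ℕ, 1 ≤ n ∧ f^[n] x ∈ Icc u v := by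
  have hgx := hg.lorenz.mapsTo ⟨hx.1.le, hx.2.le⟩
  by_cases hfree : ∀ i, f^[i] x ≠ c
  · rcases lt_or_gt_of_ne hxc with hlt | hlt
    · exact ⟨l, hg.one_lt_l.le, hg.eq_left x ⟨hx.1.le, hlt⟩ (fun i _ => hfree i) ▸ hgx⟩
    · exact ⟨r, hg.one_lt_r.le, hg.eq_right x ⟨hlt, hx.2.le⟩ (fun i _ => hfree i) ▸ hgx⟩
  · push Not at hfree
    obtain ⟨i, hi⟩ := hfree
    refine ⟨i, Nat.one_le_iff_ne_zero.2 ?_, hi ▸ ⟨hg.u_lt_c.le, hg.c_lt_v.le⟩⟩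
    rintro rfl
    exact hxc hi

end IsRenormalization

theorem cFreeEnters_iff_exists_iterate_mem {f : ℝ → ℝ} {c x : ℝ} {S : Set ℝ} (hc : c ∈ S) :
    CFreeEnters f c S x ↔ ∃ n : ℕ, f^[n] x ∈ S := by
  classical
  refine ⟨fun ⟨n, _, hn⟩ => ⟨n, hn⟩, fun h => ⟨Nat.find h, fun i hi hic => ?_, Nat.find_spec h⟩⟩
  exact Nat.find_min h hi (hic ▸ hc)

/-- invariance of `F_g` is equivalent to the orbits of `u` and `v`
entering `(u,v)`. -/
theorem Fg_invariant_iff_orbits_enter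
    (f g : ℝ → ℝ) (c u v : ℝ) (l r : ℕ)
    (hf : IsExpandingLorenz f c) (hg : IsRenormalization f c l r u v g)
    (Fg : Set ℝ)
    (hFg : Fg = {x ∈ Set.Icc (0:ℝ) 1 | CFreeEnters f c (Set.Ioo u v) x}) :
    ((0:ℝ) ∈ Fg ∧ (1:ℝ) ∈ Fg ∧ ∀ x ∈ Fg, x ≠ c → f x ∈ Fg) ↔
      ((∃ i : ℕ, 1 ≤ i ∧ f^[i] u ∈ Set.Ioo u v) ∧
       (∃ j : ℕ, 1 ≤ j ∧ f^[j] v ∈ Set.Ioo u v)) := by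
  have hc : c ∈ Ioo u v := ⟨hg.u_lt_c, hg.c_lt_v⟩
  have hmem : ∀ x, x ∈ Fg ↔ x ∈ Icc (0 : ℝ) 1 ∧ ∃ n : ℕ, f^[n] x ∈ Ioo u v := fun x => by
    rw [hFg, mem_ofPred_eq, cFreeEnters_iff_exists_iterate_mem hc]
  obtain ⟨m, hm, hmu⟩ := hg.exists_iterate_zero_eq hf
  obtain ⟨k, hk, hkv⟩ := hg.exists_iterate_one_eq hf
  constructor
  · rintro ⟨h0, h1, hinv⟩
    have orbit : ∀ (x : ℝ) (n : ℕ), x ∈ Fg → (∀ i < n, f^[i] x ≠ c) → f^[n] x ∈ Fg := by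
      intro x n hx
      induction n with
      | zero => exact fun _ => hx
      | succ n ih =>
        intro hn
        rw [iterate_succ_apply']
        exact hinv _ (ih fun i hi => hn i (hi.trans n.lt_succ_self)) (hn n n.lt_succ_self)
    have enters : ∀ x ∈ Fg, x ∉ Ioo u v → ∃ i : ℕ, 1 ≤ i ∧ f^[i] x ∈ Ioo u v := by
      intro x hx hxuv
      obtain ⟨n, hn⟩ := ((hmem x).1 hx).2
      refine ⟨n, Nat.one_le_iff_ne_zero.2 ?_, hn⟩
      rintro rfl
      exact hxuv hn
    exact ⟨enters u (hmu ▸ orbit 0 m h0 hm) (by simp), enters v (hkv ▸ orbit 1 k h1 hk) (by simp)⟩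
  · rintro ⟨⟨i, -, hi⟩, j, -, hj⟩
    have of_iterate : ∀ (x : ℝ) (n p : ℕ), f^[p] (f^[n] x) ∈ Ioo u v →
        f^[p + n] x ∈ Ioo u v := fun x n p h => by rwa [iterate_add_apply]
    refine ⟨(hmem 0).2 ⟨by simp, i + m, of_iterate 0 m i (hmu.symm ▸ hi)⟩,
      (hmem 1).2 ⟨by simp, j + k, of_iterate 1 k j (hkv.symm ▸ hj)⟩, fun x hx hxc => ?_⟩
    obtain ⟨hx01, n, hn⟩ := (hmem x).1 hx
    have return_pos : ∃ p : ℕ, f^[p + 1] x ∈ Ioo u v := by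
      rcases n with _ | n
      · obtain ⟨q, hq1, hq⟩ := hg.exists_iterate_mem_Icc hn hxc
        obtain ⟨q, rfl⟩ := Nat.exists_eq_add_of_le' hq1
        rcases eq_endpoints_or_mem_Ioo_of_mem_Icc hq with h | h | h
        · exact ⟨i + q, of_iterate x (q + 1) i (h.symm ▸ hi)⟩
        · exact ⟨j + q, of_iterate x (q + 1) j (h.symm ▸ hj)⟩
        · exact ⟨q, h⟩
      · exact ⟨n, hn⟩
    exact (hmem _).2 ⟨hf.mapsTo hx01, return_pos⟩
end

section
/- Let f be an expanding Lorenz map with critical point c and let g = (f^l, f^r) be a renormalization of f with renormalization interval [u,v]. Suppose that the forward orbit of u enters (u,v) and the forward orbit of v enters (u,v), i.e. there exist i, j ≥ 1 with f^i(u) ∈ (u,v) and f^j(v) ∈ (u,v). Then f(0) > 0 and f(1) < 1; in particular f has no fixed point in [0,1] ∖ {c}. -/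
open Set Filter Topology Function

/-- A continuous function whose derivative is nonnegative off a finite set is monotone. -/
theorem le_of_hasDerivAt_nonneg_off_finset (h : ℝ → ℝ) (F : Finset ℝ) :
    ∀ a b : ℝ, a ≤ b → ContinuousOn h (Set.Icc a b) →
      (∀ x ∈ Set.Ioo a b, x ∉ F → ∃ d : ℝ, HasDerivAt h d x ∧ 0 ≤ d) → h a ≤ h b := by
  induction F using Finset.induction_on with
  | empty =>
    intro a b hab hc hd
    refine monotoneOn_of_deriv_nonneg (convex_Icc a b) hc ?_ ?_
      (left_mem_Icc.2 hab) (right_mem_Icc.2 hab) hab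
    · intro x hx
      rw [interior_Icc] at hx
      obtain ⟨d, hd, -⟩ := hd x hx (by simp)
      exact hd.differentiableAt.differentiableWithinAt
    · intro x hx
      rw [interior_Icc] at hx
      obtain ⟨d, hd, h0⟩ := hd x hx (by simp)
      rwa [hd.deriv]
  | insert p F _ ih =>
    intro a b hab hc hd
    by_cases hp : p ∈ Set.Ioo a b
    · refine (ih a p hp.1.le (hc.mono (Icc_subset_Icc_right hp.2.le)) ?_).trans
        (ih p b hp.2.le (hc.mono (Icc_subset_Icc_left hp.1.le)) ?_)
      · intro x hx hxF
        exact hd x ⟨hx.1, hx.2.trans hp.2⟩ (by simp [hx.2.ne, hxF])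
      · intro x hx hxF
        exact hd x ⟨hp.1.trans hx.1, hx.2⟩ (by simp [hx.1.ne', hxF])
    · refine ih a b hab hc fun x hx hxF => hd x hx ?_
      have : x ≠ p := fun e => hp (e ▸ hx)
      simp [this, hxF]

/-- An expanding Lorenz map does not contract distances inside a branch. -/
theorem IsExpandingLorenzOn.sub_le_sub {f : ℝ → ℝ} {c a b x y : ℝ}
    (hf : IsExpandingLorenzOn f c a b) (hxy : x ≤ y) (hsub : Set.Icc x y ⊆ Set.Icc a b)
    (hc : ContinuousOn f (Set.Icc x y)) : f x - x ≤ f y - y := by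
  obtain ⟨F, hF, lam, hlam, hd⟩ := hf.expanding
  refine le_of_hasDerivAt_nonneg_off_finset (fun t => f t - t) hF.toFinset x y hxy
    (hc.sub continuousOn_id) fun t ht htF => ?_
  obtain ⟨d, hd, hld⟩ := hd t ⟨hsub (Ioo_subset_Icc_self ht), by simpa using htF⟩
  have hnhds : Set.Icc a b ∈ 𝓝 t := mem_of_superset (Icc_mem_nhds ht.1 ht.2) hsub
  exact ⟨d - 1, (hd.hasDerivAt hnhds).sub (hasDerivAt_id t), by linarith⟩

/-- If the left endpoint is fixed, all iterates send the right side of `c` to the left endpoint. -/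
theorem IsExpandingLorenzOn.tendsto_iterate_right {f : ℝ → ℝ} {c a b : ℝ}
    (hf : IsExpandingLorenzOn f c a b) (ha : f a = a) (n : ℕ) :
    Tendsto f^[n + 1] (𝓝[>] c) (𝓝[>] a) := by
  have hca := hf.a_lt_c
  have hcb := hf.c_lt_b
  have hfix : Tendsto f (𝓝[>] a) (𝓝[>] a) := by
    refine tendsto_nhdsWithin_iff.2 ⟨?_, ?_⟩
    · have h := (hf.cont_left a ⟨le_rfl, hca⟩).tendsto
      rw [ha] at h
      refine h.mono_left (nhdsWithin_le_of_mem ?_)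
      exact mem_of_superset (Ioo_mem_nhdsGT hca) Ioo_subset_Ico_self
    · filter_upwards [Ioo_mem_nhdsGT hca] with x hx
      have := hf.mono_left ⟨le_rfl, hca⟩ (Ioo_subset_Ico_self hx) hx.1
      rwa [ha] at this
  have hcrit : Tendsto f (𝓝[>] c) (𝓝[>] a) := by
    refine tendsto_nhdsWithin_iff.2 ⟨hf.lim_right, ?_⟩
    filter_upwards [Ioo_mem_nhdsGT hcb] with x hx
    obtain ⟨hcx, hxb⟩ := hx
    have hm : (c + x) / 2 ∈ Set.Ioc c b := ⟨by linarith, by linarith⟩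
    have hlt := hf.mono_right hm ⟨hcx, hxb.le⟩ (by linarith)
    have := (hf.mapsTo ⟨hca.le.trans hm.1.le, hm.2⟩).1
    exact this.trans_lt hlt
  rw [Function.iterate_succ]
  exact (hfix.iterate n).comp hcrit

/-- If the right endpoint is fixed, all iterates send the left side of `c` to the right endpoint. -/
theorem IsExpandingLorenzOn.tendsto_iterate_left {f : ℝ → ℝ} {c a b : ℝ}
    (hf : IsExpandingLorenzOn f c a b) (hb : f b = b) (n : ℕ) :
    Tendsto f^[n + 1] (𝓝[<] c) (𝓝[<] b) := by
  have hca := hf.a_lt_c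
  have hcb := hf.c_lt_b
  have hfix : Tendsto f (𝓝[<] b) (𝓝[<] b) := by
    refine tendsto_nhdsWithin_iff.2 ⟨?_, ?_⟩
    · have h := (hf.cont_right b ⟨hcb, le_rfl⟩).tendsto
      rw [hb] at h
      refine h.mono_left (nhdsWithin_le_of_mem ?_)
      exact mem_of_superset (Ioo_mem_nhdsLT hcb) Ioo_subset_Ioc_self
    · filter_upwards [Ioo_mem_nhdsLT hcb] with x hx
      have := hf.mono_right (Ioo_subset_Ioc_self hx) ⟨hcb, le_rfl⟩ hx.2
      rwa [hb] at this
  have hcrit : Tendsto f (𝓝[<] c) (𝓝[<] b) := by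
    refine tendsto_nhdsWithin_iff.2 ⟨hf.lim_left, ?_⟩
    filter_upwards [Ioo_mem_nhdsLT hca] with x hx
    obtain ⟨hax, hxc⟩ := hx
    have hm : (c + x) / 2 ∈ Set.Ico a c := ⟨by linarith, by linarith⟩
    have hlt := hf.mono_left ⟨hax.le, hxc⟩ hm (by linarith)
    have := (hf.mapsTo ⟨hm.1, hm.2.le.trans hcb.le⟩).2
    exact hlt.trans_le this
  rw [Function.iterate_succ]
  exact (hfix.iterate n).comp hcrit

/-- if the orbits of both endpoints of a renormalization interval
enter `(u,v)`, then `f 0 > 0`, `f 1 < 1` and `f` has no fixed point off `c`. -/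
theorem no_fixed_points_of_orbits_enter
    (f g : ℝ → ℝ) (c u v : ℝ) (l r : ℕ)
    (hf : IsExpandingLorenz f c) (hg : IsRenormalization f c l r u v g)
    (hu : ∃ i : ℕ, 1 ≤ i ∧ f^[i] u ∈ Set.Ioo u v)
    (hv : ∃ j : ℕ, 1 ≤ j ∧ f^[j] v ∈ Set.Ioo u v) :
    0 < f 0 ∧ f 1 < 1 ∧ ∀ x ∈ Set.Icc (0:ℝ) 1, x ≠ c → f x ≠ x := by
  have hf : IsExpandingLorenzOn f c 0 1 := hf
  have h0 : 0 < f 0 := by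
    refine lt_of_le_of_ne (hf.mapsTo ⟨le_rfl, zero_le_one⟩).1 fun h => ?_
    obtain ⟨n, rfl⟩ := Nat.exists_eq_add_of_lt hg.one_lt_r
    have hu0 : u = 0 := tendsto_nhds_unique hg.lim_c_right
      ((hf.tendsto_iterate_right h.symm _).mono_right nhdsWithin_le_nhds)
    obtain ⟨i, -, hi⟩ := hu
    rw [hu0, Function.iterate_fixed h.symm] at hi
    exact lt_irrefl _ hi.1
  have h1 : f 1 < 1 := by
    refine lt_of_le_of_ne (hf.mapsTo ⟨zero_le_one, le_rfl⟩).2 fun h => ?_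
    obtain ⟨n, rfl⟩ := Nat.exists_eq_add_of_lt hg.one_lt_l
    have hv1 : v = 1 := tendsto_nhds_unique hg.lim_c_left
      ((hf.tendsto_iterate_left h _).mono_right nhdsWithin_le_nhds)
    obtain ⟨j, -, hj⟩ := hv
    rw [hv1, Function.iterate_fixed h] at hj
    exact lt_irrefl _ hj.2
  refine ⟨h0, h1, fun x hx hxc hfx => ?_⟩
  rcases lt_or_gt_of_ne hxc with hlt | hgt
  · have := hf.sub_le_sub hx.1 (Icc_subset_Icc_right hx.2)
      (hf.cont_left.mono fun t ht => ⟨ht.1, ht.2.trans_lt hlt⟩)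
    linarith
  · have := hf.sub_le_sub hx.2 (Icc_subset_Icc_left hx.1)
      (hf.cont_right.mono fun t ht => ⟨hgt.trans_le ht.1, ht.2⟩)
    linarith
end

section
/- Let f be an expanding Lorenz map with critical point c and let g = (f^l, f^r) be a renormalization of f with renormalization interval [u,v]. Suppose that the forward orbit of u enters (u,v) and the forward orbit of v enters (u,v), and that moreover f(u) ∈ (u,v) or f(v) ∈ (u,v). Then F_g = [0,1], i.e. for every x ∈ [0,1] there is n ≥ 0 with f^i(x) ≠ c for 0 ≤ i < n and f^n(x) ∈ (u,v). -/
open Set Filter Topology Function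

/-- A continuous function with nonnegative derivative off a finite set does not decrease. -/
lemma le_of_hasDerivAt_nonneg_off_finite {F : Set ℝ} (hF : F.Finite) (h : ℝ → ℝ) :
    ∀ a b : ℝ, a ≤ b → ContinuousOn h (Set.Icc a b) →
      (∀ x ∈ Set.Ioo a b, x ∉ F → ∃ d : ℝ, HasDerivAt h d x ∧ 0 ≤ d) → h a ≤ h b := by
  induction F, hF using Set.Finite.induction_on with
  | empty =>
    intro a b hab hc hd
    have hm : MonotoneOn h (Set.Icc a b) := by
      apply monotoneOn_of_deriv_nonneg (convex_Icc a b) hc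
      · intro x hx
        rw [interior_Icc] at hx
        obtain ⟨d, hd, -⟩ := hd x hx (Set.notMem_empty x)
        exact hd.differentiableAt.differentiableWithinAt
      · intro x hx
        rw [interior_Icc] at hx
        obtain ⟨d, hd, h0⟩ := hd x hx (Set.notMem_empty x)
        rwa [hd.deriv]
    exact hm (Set.left_mem_Icc.2 hab) (Set.right_mem_Icc.2 hab) hab
  | @insert p F _ _ ih =>
    intro a b hab hc hd
    by_cases hp : p ∈ Set.Ioo a b
    · refine (ih a p hp.1.le (hc.mono (Set.Icc_subset_Icc_right hp.2.le)) ?_).trans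
        (ih p b hp.2.le (hc.mono (Set.Icc_subset_Icc_left hp.1.le)) ?_)
      · intro x hx hxF
        refine hd x ⟨hx.1, hx.2.trans hp.2⟩ ?_
        rintro (rfl | h)
        · exact lt_irrefl _ hx.2
        · exact hxF h
      · intro x hx hxF
        refine hd x ⟨hp.1.trans hx.1, hx.2⟩ ?_
        rintro (rfl | h)
        · exact lt_irrefl _ hx.1
        · exact hxF h
    · refine ih a b hab hc fun x hx hxF => hd x hx ?_
      rintro (rfl | h)
      · exact hp hx
      · exact hxF h

/-- A bounded nonnegative sequence growing by a factor `lam > 1` at each step starts at `0`. -/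
lemma eq_zero_of_bounded_of_mul_le {lam : ℝ} (hlam : 1 < lam) {s : ℕ → ℝ}
    (h0 : 0 ≤ s 0) (h1 : ∀ n, s n ≤ 1) (hs : ∀ n, lam * s n ≤ s (n + 1)) : s 0 = 0 := by
  have hpow : ∀ n, lam ^ n * s 0 ≤ s n := by
    intro n
    induction n with
    | zero => simp
    | succ n ih =>
      calc lam ^ (n + 1) * s 0 = lam * (lam ^ n * s 0) := by ring
        _ ≤ lam * s n := by gcongr
        _ ≤ s (n + 1) := hs n
  by_contra hne
  have hpos : 0 < s 0 := lt_of_le_of_ne h0 (Ne.symm hne)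
  obtain ⟨n, hn⟩ := pow_unbounded_of_one_lt (1 / s 0) hlam
  have := (div_lt_iff₀ hpos).1 hn
  linarith [hpow n, h1 n]

namespace IsExpandingLorenzOn

variable {f : ℝ → ℝ} {c : ℝ}

/-- An expanding Lorenz map stretches intervals on which it is continuous by a uniform factor. -/
lemma exists_expansion {a b : ℝ} (hf : IsExpandingLorenzOn f c a b) :
    ∃ lam : ℝ, 1 < lam ∧ ∀ x y : ℝ, a ≤ x → x ≤ y → y ≤ b → ContinuousOn f (Set.Icc x y) →
      lam * (y - x) ≤ f y - f x := by
  obtain ⟨F, hF, lam, hlam, hd⟩ := hf.expanding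
  refine ⟨lam, hlam, fun x y hx hxy hy hc => ?_⟩
  have := le_of_hasDerivAt_nonneg_off_finite hF (fun t => f t - lam * t) x y hxy
    (hc.sub (by fun_prop)) ?_
  · linarith
  · intro t ht htF
    have hta : a < t := hx.trans_lt ht.1
    have htb : t < b := ht.2.trans_le hy
    obtain ⟨d, hd, hld⟩ := hd t ⟨⟨hta.le, htb.le⟩, htF⟩
    have hd' := hd.hasDerivAt (Icc_mem_nhds hta htb)
    refine ⟨d - lam * 1, hd'.sub ((hasDerivAt_id t).const_mul lam), by linarith⟩

lemma iterate_mem_Icc (hf : IsExpandingLorenzOn f c 0 1) {x : ℝ} (hx : x ∈ Set.Icc (0 : ℝ) 1)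
    (n : ℕ) : f^[n] x ∈ Set.Icc (0 : ℝ) 1 :=
  hf.mapsTo.iterate n hx

/-- The only orbit staying on the left of `c` is that of a fixed point `0`. -/
lemma eq_zero_of_iterate_lt (hf : IsExpandingLorenzOn f c 0 1) {x : ℝ}
    (hx : x ∈ Set.Icc (0 : ℝ) 1) (h : ∀ n, f^[n] x < c) : x = 0 := by
  obtain ⟨lam, hlam, hexp⟩ := hf.exists_expansion
  refine eq_zero_of_bounded_of_mul_le hlam (s := fun n => f^[n] x) hx.1
    (fun n => (hf.iterate_mem_Icc hx n).2) fun n => ?_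
  have hm := hf.iterate_mem_Icc hx n
  have := hexp 0 (f^[n] x) le_rfl hm.1 hm.2
    (hf.cont_left.mono fun t ht => ⟨ht.1, ht.2.trans_lt (h n)⟩)
  have h0 := (hf.mapsTo (show (0 : ℝ) ∈ Set.Icc (0 : ℝ) 1 by simp)).1
  simp only [Function.iterate_succ_apply']
  linarith

/-- The only orbit staying on the right of `c` is that of a fixed point `1`. -/
lemma eq_one_of_lt_iterate (hf : IsExpandingLorenzOn f c 0 1) {x : ℝ}
    (hx : x ∈ Set.Icc (0 : ℝ) 1) (h : ∀ n, c < f^[n] x) : x = 1 := by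
  obtain ⟨lam, hlam, hexp⟩ := hf.exists_expansion
  have := eq_zero_of_bounded_of_mul_le hlam (s := fun n => 1 - f^[n] x)
    (sub_nonneg.2 hx.2) (fun n => by linarith [(hf.iterate_mem_Icc hx n).1]) fun n => ?_
  · simp only [Function.iterate_zero, id] at this
    linarith
  have hm := hf.iterate_mem_Icc hx n
  have := hexp (f^[n] x) 1 hm.1 hm.2 le_rfl
    (hf.cont_right.mono fun t ht => ⟨(h n).trans_le ht.1, ht.2⟩)
  have h1 := (hf.mapsTo (show (1 : ℝ) ∈ Set.Icc (0 : ℝ) 1 by simp)).2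
  simp only [Function.iterate_succ_apply']
  linarith

end IsExpandingLorenzOn

/-- Iterates of a map of `[0,1]` that is continuous at a fixed point `p` keep the limit `p`. -/
lemma tendsto_iterate_of_fixed {f : ℝ → ℝ} {p : ℝ} {φ : Filter ℝ}
    (hmaps : Set.MapsTo f (Set.Icc 0 1) (Set.Icc 0 1))
    (hcont : ContinuousWithinAt f (Set.Icc 0 1) p) (hp : f p = p)
    (hφ : Filter.Tendsto f φ (nhds p)) (hmem : ∀ᶠ x in φ, x ∈ Set.Icc (0 : ℝ) 1)
    {n : ℕ} (hn : 1 ≤ n) : Filter.Tendsto f^[n] φ (nhds p) := by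
  induction n, hn using Nat.le_induction with
  | base => simpa using hφ
  | succ n _ ih =>
    have hw : Filter.Tendsto f^[n] φ (nhdsWithin p (Set.Icc 0 1)) :=
      tendsto_nhdsWithin_iff.2 ⟨ih, hmem.mono fun x hx => hmaps.iterate n hx⟩
    have := hcont.tendsto.comp hw
    rw [hp] at this
    rwa [Function.iterate_succ']

namespace IsRenormalization

variable {f g : ℝ → ℝ} {c u v : ℝ} {l r : ℕ}

lemma u_eq_zero_of_fixed (hf : IsExpandingLorenzOn f c 0 1)
    (hg : IsRenormalization f c l r u v g) (h0 : f 0 = 0) : u = 0 := by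
  have hcont : ContinuousWithinAt f (Set.Icc 0 1) 0 :=
    (hf.cont_left 0 ⟨le_rfl, hf.a_lt_c⟩).mono_of_mem_nhdsWithin
      (mem_nhdsWithin.2 ⟨Set.Iio c, isOpen_Iio, hf.a_lt_c, fun x hx => ⟨hx.2.1, hx.1⟩⟩)
  refine tendsto_nhds_unique hg.lim_c_right
    (tendsto_iterate_of_fixed hf.mapsTo hcont h0 hf.lim_right ?_ hg.one_lt_r.le)
  filter_upwards [Ioo_mem_nhdsGT hf.c_lt_b] with x hx
  exact ⟨hf.a_lt_c.le.trans hx.1.le, hx.2.le⟩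

lemma v_eq_one_of_fixed (hf : IsExpandingLorenzOn f c 0 1)
    (hg : IsRenormalization f c l r u v g) (h1 : f 1 = 1) : v = 1 := by
  have hcont : ContinuousWithinAt f (Set.Icc 0 1) 1 :=
    (hf.cont_right 1 ⟨hf.c_lt_b, le_rfl⟩).mono_of_mem_nhdsWithin
      (mem_nhdsWithin.2 ⟨Set.Ioi c, isOpen_Ioi, hf.c_lt_b, fun x hx => ⟨hx.1, hx.2.2⟩⟩)
  refine tendsto_nhds_unique hg.lim_c_left
    (tendsto_iterate_of_fixed hf.mapsTo hcont h1 hf.lim_left ?_ hg.one_lt_l.le)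
  filter_upwards [Ioo_mem_nhdsLT hf.a_lt_c] with x hx
  exact ⟨hx.1.le, hx.2.le.trans hf.c_lt_b.le⟩

/-- No orbit of `f` stays on the left of the renormalization interval. -/
lemma exists_le_iterate (hf : IsExpandingLorenzOn f c 0 1)
    (hg : IsRenormalization f c l r u v g) {x : ℝ} (hx : x ∈ Set.Icc (0 : ℝ) 1) :
    ∃ n, u ≤ f^[n] x := by
  by_contra! h
  have hx0 := hf.eq_zero_of_iterate_lt hx fun n => (h n).trans hg.u_lt_c
  have hfx0 := hf.eq_zero_of_iterate_lt (hf.mapsTo hx)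
    fun n => by simpa using (h (n + 1)).trans hg.u_lt_c
  rw [hx0] at hfx0
  have := h 0
  rw [hg.u_eq_zero_of_fixed hf hfx0, hx0] at this
  exact lt_irrefl _ this

/-- No orbit of `f` stays on the right of the renormalization interval. -/
lemma exists_iterate_le (hf : IsExpandingLorenzOn f c 0 1)
    (hg : IsRenormalization f c l r u v g) {x : ℝ} (hx : x ∈ Set.Icc (0 : ℝ) 1) :
    ∃ n, f^[n] x ≤ v := by
  by_contra! h
  have hx1 := hf.eq_one_of_lt_iterate hx fun n => hg.c_lt_v.trans (h n)
  have hfx1 := hf.eq_one_of_lt_iterate (hf.mapsTo hx)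
    fun n => by simpa using hg.c_lt_v.trans (h (n + 1))
  rw [hx1] at hfx1
  have := h 0
  rw [hg.v_eq_one_of_fixed hf hfx1, hx1] at this
  exact lt_irrefl _ this

end IsRenormalization

/-- if additionally `f u ∈ (u,v)` or `f v ∈ (u,v)`, then `F_g = [0,1]`. -/
theorem Fg_eq_unit_interval
    (f g : ℝ → ℝ) (c u v : ℝ) (l r : ℕ)
    (hf : IsExpandingLorenz f c) (hg : IsRenormalization f c l r u v g)
    (hu : ∃ i : ℕ, 1 ≤ i ∧ f^[i] u ∈ Set.Ioo u v)
    (hv : ∃ j : ℕ, 1 ≤ j ∧ f^[j] v ∈ Set.Ioo u v)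
    (h1 : f u ∈ Set.Ioo u v ∨ f v ∈ Set.Ioo u v) :
    ∀ x ∈ Set.Icc (0:ℝ) 1, ∃ m : ℕ, (∀ i < m, f^[i] x ≠ c) ∧ f^[m] x ∈ Set.Ioo u v := by
  have hf' : IsExpandingLorenzOn f c 0 1 := hf
  intro x hx
  suffices h : ∃ m, f^[m] x ∈ Set.Ioo u v by
    classical
    refine ⟨Nat.find h, fun i hi hic => Nat.find_min h hi ?_, Nat.find_spec h⟩
    rw [hic]
    exact ⟨hg.u_lt_c, hg.c_lt_v⟩
  by_contra! hJ
  have hside : ∀ n, f^[n] x < u ∨ v < f^[n] x := by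
    intro n
    by_contra! h
    rcases h.1.eq_or_lt with hun | hun
    · obtain ⟨i, -, hi⟩ := hu
      have hi' : f^[i] (f^[n] x) ∈ Set.Ioo u v := hun ▸ hi
      rw [← Function.iterate_add_apply] at hi'
      exact hJ _ hi'
    rcases h.2.eq_or_lt with hvn | hvn
    · obtain ⟨j, -, hj⟩ := hv
      have hj' : f^[j] (f^[n] x) ∈ Set.Ioo u v := hvn.symm ▸ hj
      rw [← Function.iterate_add_apply] at hj'
      exact hJ _ hj'
    exact hJ n ⟨hun, hvn⟩
  have hmem := hf'.iterate_mem_Icc hx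
  have huv : u < v := hg.u_lt_c.trans hg.c_lt_v
  rcases h1 with h1 | h1
  · have hleft : ∀ n, v < f^[n] x := by
      intro n
      refine (hside n).resolve_left fun hn => ?_
      obtain ⟨k, hk⟩ := hg.exists_le_iterate hf' (hmem n)
      refine hk.not_gt ?_
      clear hk
      induction k with
      | zero => exact hn
      | succ k ih =>
        rw [← Function.iterate_add_apply] at ih
        rw [Function.iterate_succ_apply', ← Function.iterate_add_apply]
        have hlt := hf'.mono_left ⟨(hmem (k + n)).1, ih.trans hg.u_lt_c⟩
          ⟨hg.u_nonneg, hg.u_lt_c⟩ ih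
        rcases hside (k + n + 1) with h | h <;> rw [Function.iterate_succ_apply'] at h
        · exact h
        · linarith [h1.2]
    obtain ⟨k, hk⟩ := hg.exists_iterate_le hf' hx
    exact hk.not_gt (hleft k)
  · have hright : ∀ n, f^[n] x < u := by
      intro n
      refine (hside n).resolve_right fun hn => ?_
      obtain ⟨k, hk⟩ := hg.exists_iterate_le hf' (hmem n)
      refine hk.not_gt ?_
      clear hk
      induction k with
      | zero => exact hn
      | succ k ih =>
        rw [← Function.iterate_add_apply] at ih
        rw [Function.iterate_succ_apply', ← Function.iterate_add_apply]
        have hlt := hf'.mono_right ⟨hg.c_lt_v, hg.v_le_one⟩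
          ⟨hg.c_lt_v.trans ih, (hmem (k + n)).2⟩ ih
        rcases hside (k + n + 1) with h | h <;> rw [Function.iterate_succ_apply'] at h
        · linarith [h1.1]
        · exact h
    obtain ⟨k, hk⟩ := hg.exists_le_iterate hf' hx
    exact hk.not_gt (hright k)
end

section
/- Let f be an expanding Lorenz map with critical point c and let 1 < κ < ∞. Suppose f has no c-free periodic point of period strictly less than κ. Then any two c-free periodic orbits of f of period κ coincide; in other words, f has at most one c-free periodic orbit of period κ. -/
open Set Filter Topology Function

theorem mul_sub_le_sub_of_hasDerivAt_off_finset {f : ℝ → ℝ} {lam : ℝ} (F : Finset ℝ) :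
    ∀ u v : ℝ, u ≤ v → ContinuousOn f (Icc u v) →
      (∀ x ∈ Ioo u v, x ∉ F → ∃ d, HasDerivAt f d x ∧ lam ≤ d) →
      lam * (v - u) ≤ f v - f u := by
  induction F using Finset.induction_on with
  | empty =>
    intro u v huv hc hd
    rcases huv.eq_or_lt with rfl | huv
    · simp
    have hd' : ∀ x ∈ Ioo u v, HasDerivAt f (deriv f x) x := by
      intro x hx
      obtain ⟨d, h, -⟩ := hd x hx (by simp)
      exact h.differentiableAt.hasDerivAt
    obtain ⟨x, hx, hslope⟩ := exists_hasDerivAt_eq_slope f (deriv f) huv hc hd'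
    obtain ⟨d, h, hle⟩ := hd x hx (by simp)
    rw [h.deriv] at hslope
    rw [hslope, le_div_iff₀ (by linarith)] at hle
    exact hle
  | insert a F _ ih =>
    intro u v huv hc hd
    by_cases ha : a ∈ Ioo u v
    · have h1 := ih u a ha.1.le (hc.mono (Icc_subset_Icc_right ha.2.le))
        (fun x hx hxF => hd x ⟨hx.1, hx.2.trans ha.2⟩ (by simp [hxF, hx.2.ne]))
      have h2 := ih a v ha.2.le (hc.mono (Icc_subset_Icc_left ha.1.le))
        (fun x hx hxF => hd x ⟨ha.1.trans hx.1, hx.2⟩ (by simp [hxF, hx.1.ne']))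
      linarith
    · refine ih u v huv hc (fun x hx hxF => hd x hx ?_)
      have : x ≠ a := by rintro rfl; exact ha hx
      simp [hxF, this]

/-- `x` and `y` lie in the same branch domain of a Lorenz map on `[0,1]`. -/
def SameBranch (c x y : ℝ) : Prop :=
  (0 ≤ x ∧ x < c ∧ 0 ≤ y ∧ y < c) ∨ (c < x ∧ x ≤ 1 ∧ c < y ∧ y ≤ 1)

namespace IsExpandingLorenz

variable {f : ℝ → ℝ} {c : ℝ}

theorem continuousOn_Icc (hf : IsExpandingLorenz f c) {u v : ℝ}
    (h : (0 ≤ u ∧ v < c) ∨ (c < u ∧ v ≤ 1)) : ContinuousOn f (Icc u v) := by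
  rcases h with h | h
  · exact hf.cont_left.mono (fun x hx => ⟨h.1.trans hx.1, hx.2.trans_lt h.2⟩)
  · exact hf.cont_right.mono (fun x hx => ⟨h.1.trans_le hx.1, hx.2.trans h.2⟩)

theorem lt_iff_of_left (hf : IsExpandingLorenz f c) {u v : ℝ} (hu : 0 ≤ u) (hv : 0 ≤ v)
    (huc : u < c) (hvc : v < c) : f u < f v ↔ u < v :=
  hf.mono_left.lt_iff_lt ⟨hu, huc⟩ ⟨hv, hvc⟩

theorem lt_iff_of_right (hf : IsExpandingLorenz f c) {u v : ℝ} (hu : u ≤ 1) (hv : v ≤ 1)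
    (huc : c < u) (hvc : c < v) : f u < f v ↔ u < v :=
  hf.mono_right.lt_iff_lt ⟨huc, hu⟩ ⟨hvc, hv⟩

theorem le_iff_of_left (hf : IsExpandingLorenz f c) {u v : ℝ} (hu : 0 ≤ u) (hv : 0 ≤ v)
    (huc : u < c) (hvc : v < c) : f u ≤ f v ↔ u ≤ v :=
  hf.mono_left.le_iff_le ⟨hu, huc⟩ ⟨hv, hvc⟩

theorem le_iff_of_right (hf : IsExpandingLorenz f c) {u v : ℝ} (hu : u ≤ 1) (hv : v ≤ 1)
    (huc : c < u) (hvc : c < v) : f u ≤ f v ↔ u ≤ v :=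
  hf.mono_right.le_iff_le ⟨huc, hu⟩ ⟨hvc, hv⟩

theorem exists_expansion (hf : IsExpandingLorenz f c) :
    ∃ lam : ℝ, 1 < lam ∧ ∀ x y, SameBranch c x y → lam * |x - y| ≤ |f x - f y| := by
  obtain ⟨F, hF, lam, hlam, hd⟩ := hf.expanding
  refine ⟨lam, hlam, ?_⟩
  have hc0 := hf.a_lt_c
  have hc1 := hf.c_lt_b
  have key : ∀ x y, x ≤ y → SameBranch c x y → lam * (y - x) ≤ f y - f x := by
    intro x y hxy h
    have hx : 0 ≤ x := by rcases h with h | h <;> linarith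
    have hy : y ≤ 1 := by rcases h with h | h <;> linarith
    refine mul_sub_le_sub_of_hasDerivAt_off_finset hF.toFinset x y hxy
      (hf.continuousOn_Icc ?_) ?_
    · rcases h with h | h
      · exact Or.inl ⟨h.1, h.2.2.2⟩
      · exact Or.inr ⟨h.1, h.2.2.2⟩
    · intro z hz hzF
      have h0 : 0 < z := hx.trans_lt hz.1
      have h1 : z < 1 := hz.2.trans_le hy
      obtain ⟨d, hd, hle⟩ := hd z ⟨⟨h0.le, h1.le⟩, by simpa using hzF⟩
      exact ⟨d, hd.hasDerivAt (Icc_mem_nhds h0 h1), hle⟩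
  intro x y h
  rcases le_total x y with hxy | hxy
  · have := key x y hxy h
    rw [abs_sub_comm x y, abs_sub_comm (f x), abs_of_nonneg (sub_nonneg.2 hxy)]
    exact this.trans (le_abs_self _)
  · have hs : SameBranch c y x := by unfold SameBranch at *; tauto
    have := key y x hxy hs
    rw [abs_of_nonneg (sub_nonneg.2 hxy)]
    exact this.trans (le_abs_self _)

theorem eq_of_sameBranch_iterate (hf : IsExpandingLorenz f c) {x y : ℝ}
    (h : ∀ n, SameBranch c (f^[n] x) (f^[n] y)) : x = y := by
  obtain ⟨lam, hlam, hexp⟩ := hf.exists_expansion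
  have hc0 := hf.a_lt_c
  have hc1 := hf.c_lt_b
  have hpow : ∀ n, lam ^ n * |x - y| ≤ |f^[n] x - f^[n] y| := by
    intro n
    induction n with
    | zero => simp
    | succ n ih =>
      rw [iterate_succ_apply', iterate_succ_apply', pow_succ']
      have := hexp _ _ (h n)
      nlinarith
  by_contra hne
  have hpos : 0 < |x - y| := abs_pos.2 (sub_ne_zero.2 hne)
  obtain ⟨n, hn⟩ := pow_unbounded_of_one_lt (1 / |x - y|) hlam
  rw [div_lt_iff₀ hpos] at hn
  have h1 : |f^[n] x - f^[n] y| ≤ 1 := by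
    rw [abs_le]
    rcases h n with h | h <;> constructor <;> linarith
  linarith [hpow n]

/-- A chain of intervals, each covering the next one under a single branch of `f`, contains an
interval following the chain and mapped onto its last member. -/
theorem exists_Icc_of_chain (hf : IsExpandingLorenz f c) (m : ℕ) : ∀ a b : ℕ → ℝ,
    (∀ t < m, (0 ≤ a t ∧ b t < c) ∨ (c < a t ∧ b t ≤ 1)) → (∀ t ≤ m, a t ≤ b t) →
    (∀ t < m, f (a t) ≤ a (t + 1)) → (∀ t < m, b (t + 1) ≤ f (b t)) →
    ∃ u v, a 0 ≤ u ∧ u ≤ v ∧ v ≤ b 0 ∧ ContinuousOn f^[m] (Icc u v) ∧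
      f^[m] u = a m ∧ f^[m] v = b m ∧
      ∀ z ∈ Icc u v, ∀ t < m, a t ≤ f^[t] z ∧ f^[t] z ≤ b t := by
  induction m with
  | zero =>
    intro a b _ hab _ _
    exact ⟨a 0, b 0, le_rfl, hab 0 le_rfl, le_rfl, continuousOn_id, rfl, rfl, by simp⟩
  | succ m ih =>
    intro a b hside hab ha hb
    obtain ⟨u', v', hu', huv', hv', hcont, hu, hv, hz⟩ :=
      ih (fun t => a (t + 1)) (fun t => b (t + 1)) (fun t ht => hside _ (by omega))
        (fun t ht => hab _ (by omega)) (fun t ht => ha _ (by omega))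
        (fun t ht => hb _ (by omega))
    have h0 := hside 0 (by omega)
    have hc := hf.continuousOn_Icc h0
    have hivt := intermediate_value_Icc (hab 0 (by omega)) hc
    have ha0 := ha 0 (by omega)
    have hb0 := hb 0 (by omega)
    simp only [zero_add] at hu' hv' ha0 hb0
    obtain ⟨u, hu1, hu2⟩ := hivt ⟨ha0.trans hu', huv'.trans (hv'.trans hb0)⟩
    obtain ⟨v, hv1, hv2⟩ := hivt ⟨ha0.trans (hu'.trans huv'), hv'.trans hb0⟩
    have hmono : StrictMonoOn f (Icc (a 0) (b 0)) := by
      rcases h0 with h | h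
      · exact hf.mono_left.mono (fun x hx => ⟨h.1.trans hx.1, hx.2.trans_lt h.2⟩)
      · exact hf.mono_right.mono (fun x hx => ⟨h.1.trans_le hx.1, hx.2.trans h.2⟩)
    have huv : u ≤ v := (hmono.le_iff_le hu1 hv1).1 (by rw [hu2, hv2]; exact huv')
    have hsub : Icc u v ⊆ Icc (a 0) (b 0) := Icc_subset_Icc hu1.1 hv1.2
    have hmaps : MapsTo f (Icc u v) (Icc u' v') := by
      intro z hz
      rw [← hu2, ← hv2]
      exact ⟨(hmono.le_iff_le hu1 (hsub hz)).2 hz.1, (hmono.le_iff_le (hsub hz) hv1).2 hz.2⟩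
    refine ⟨u, v, hu1.1, huv, hv1.2, ?_, ?_, ?_, ?_⟩
    · rw [iterate_succ]
      exact hcont.comp (hc.mono hsub) hmaps
    · rw [iterate_succ_apply, hu2, hu]
    · rw [iterate_succ_apply, hv2, hv]
    · intro z hzz t ht
      cases t with
      | zero => exact hsub hzz
      | succ t =>
        rw [iterate_succ_apply]
        exact hz _ (hmaps hzz) t (by omega)

theorem exists_cFreePeriodic_of_loop (hf : IsExpandingLorenz f c) {a b : ℕ → ℝ} {m : ℕ}
    (hm : 0 < m) (hside : ∀ t < m, (0 ≤ a t ∧ b t < c) ∨ (c < a t ∧ b t ≤ 1))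
    (hab : ∀ t ≤ m, a t ≤ b t) (ha : ∀ t < m, f (a t) ≤ a (t + 1))
    (hb : ∀ t < m, b (t + 1) ≤ f (b t)) (h0 : a m ≤ a 0) (h1 : b 0 ≤ b m) :
    ∃ p, 0 < p ∧ p ≤ m ∧ ∃ z, IsCFreePeriodic f c z p := by
  obtain ⟨u, v, hu, huv, hv, hcont, hfu, hfv, hz⟩ := hf.exists_Icc_of_chain m a b hside hab ha hb
  have hc0 := hf.a_lt_c
  have hc1 := hf.c_lt_b
  obtain ⟨z, hzm, hzz⟩ := intermediate_value_Icc huv (hcont.sub continuousOn_id)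
    (show (0 : ℝ) ∈ Icc _ _ by
      simp only [Pi.sub_apply, id_eq, hfu, hfv]
      constructor <;> linarith)
  have hper : IsPeriodicPt f m z := by
    simp only [Pi.sub_apply, id_eq] at hzz
    exact sub_eq_zero.1 hzz
  have hle : minimalPeriod f z ≤ m := hper.minimalPeriod_le hm
  refine ⟨minimalPeriod f z, hper.minimalPeriod_pos hm, hle, z, ?_,
    iterate_minimalPeriod, fun i hi hlt h => ?_, fun i hi h => ?_⟩
  · have := hz z hzm 0 hm
    simp only [iterate_zero, id_eq] at this
    rcases hside 0 hm with h | h <;> constructor <;> linarith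
  · exact not_isPeriodicPt_of_pos_of_lt_minimalPeriod hi.ne' hlt h
  · have := hz z hzm i (by omega)
    rw [h] at this
    rcases hside i (by omega) with h | h <;> linarith

end IsExpandingLorenz

/-- `P` is a `c`-free periodic orbit of `f` in `[0,1]` with at least two points. -/
structure IsCFreeCycle (f : ℝ → ℝ) (c : ℝ) (P : Finset ℝ) : Prop where
  nonneg : ∀ u ∈ P, 0 ≤ u
  le_one : ∀ u ∈ P, u ≤ 1
  ne : ∀ u ∈ P, u ≠ c
  image_eq : P.image f = P
  trans : ∀ u ∈ P, ∀ v ∈ P, ∃ i < P.card, f^[i] u = v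
  one_lt_card : 1 < P.card

theorem IsCFreePeriodic.isCFreeCycle {f : ℝ → ℝ} {c x : ℝ} {κ : ℕ} (hf : IsExpandingLorenz f c)
    (hκ : 1 < κ) (hx : IsCFreePeriodic f c x κ) :
    IsCFreeCycle f c ((Finset.range κ).image (fun i => f^[i] x)) ∧
      ((Finset.range κ).image (fun i => f^[i] x)).card = κ := by
  obtain ⟨hx01, hper, hmin, hne⟩ := hx
  have hmem : ∀ i, f^[i] x ∈ Icc (0 : ℝ) 1 := fun i => hf.mapsTo.iterate i hx01
  have hlt : ∀ i j, i < j → j < κ → f^[i] x ≠ f^[j] x := by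
    intro i j hij hj h
    refine hmin (κ - j + i) (by omega) (by omega) ?_
    rw [iterate_add_apply, h, ← iterate_add_apply, Nat.sub_add_cancel hj.le, hper]
  have hcard : ((Finset.range κ).image (fun i => f^[i] x)).card = κ := by
    rw [Finset.card_image_of_injOn, Finset.card_range]
    intro i hi j hj h
    simp only [Finset.coe_range, mem_Iio] at hi hj
    by_contra hij
    rcases Nat.lt_or_gt_of_ne hij with h' | h'
    · exact hlt i j h' hj h
    · exact hlt j i h' hi h.symm
  refine ⟨⟨?_, ?_, ?_, ?_, ?_, by rw [hcard]; exact hκ⟩, hcard⟩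
  · simp only [Finset.mem_image]
    rintro _ ⟨i, _, rfl⟩
    exact (hmem i).1
  · simp only [Finset.mem_image]
    rintro _ ⟨i, _, rfl⟩
    exact (hmem i).2
  · simp only [Finset.mem_image, Finset.mem_range]
    rintro _ ⟨i, hi, rfl⟩
    exact hne i hi
  · ext y
    simp only [Finset.mem_image, Finset.mem_range]
    constructor
    · rintro ⟨_, ⟨i, hi, rfl⟩, rfl⟩
      rcases Nat.lt_or_ge (i + 1) κ with h | h
      · exact ⟨i + 1, h, iterate_succ_apply' _ _ _⟩
      · refine ⟨0, by omega, ?_⟩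
        rw [← iterate_succ_apply' f, show i.succ = κ by omega, hper, iterate_zero, id]
    · rintro ⟨i, hi, rfl⟩
      cases i with
      | zero =>
        refine ⟨_, ⟨κ - 1, by omega, rfl⟩, ?_⟩
        rw [← iterate_succ_apply' f, show (κ - 1).succ = κ by omega, hper, iterate_zero, id]
      | succ i => exact ⟨_, ⟨i, by omega, rfl⟩, (iterate_succ_apply' _ _ _).symm⟩
  · rw [hcard]
    simp only [Finset.mem_image, Finset.mem_range]
    rintro _ ⟨i, hi, rfl⟩ _ ⟨j, hj, rfl⟩
    rcases Nat.lt_or_ge j i with h | h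
    · refine ⟨j + κ - i, by omega, ?_⟩
      rw [← iterate_add_apply, show j + κ - i + i = j + κ by omega, iterate_add_apply, hper]
    · refine ⟨j - i, by omega, ?_⟩
      rw [← iterate_add_apply, Nat.sub_add_cancel h]

/-- `m`, `M` are the extreme points of the cycle `P`, and `p`, `q` its points next to `c`. -/
structure CycleFrame (f : ℝ → ℝ) (c : ℝ) (P : Finset ℝ) (m M p q : ℝ) : Prop where
  m_mem : m ∈ P
  M_mem : M ∈ P
  p_mem : p ∈ P
  q_mem : q ∈ P
  m_le : ∀ u ∈ P, m ≤ u
  le_M : ∀ u ∈ P, u ≤ M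
  p_lt : p < c
  lt_q : c < q
  le_p : ∀ u ∈ P, u < c → u ≤ p
  q_le : ∀ u ∈ P, c < u → q ≤ u
  f_p : f p = M
  f_q : f q = m

/-- `u < v` are neighbours in `P`. -/
structure Neighbours (P : Finset ℝ) (u v : ℝ) : Prop where
  left_mem : u ∈ P
  right_mem : v ∈ P
  lt : u < v
  le_left : ∀ w ∈ P, w < v → w ≤ u

theorem exists_neighbour {P : Finset ℝ} {u w : ℝ} (hu : u ∈ P) (hw : w ∈ P) (h : u < w) :
    ∃ v, Neighbours P u v ∧ v ≤ w := by
  obtain ⟨v, hv, hmin⟩ := Finset.exists_min_image (P.filter (u < ·)) id ⟨w, by simp [hw, h]⟩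
  simp only [Finset.mem_filter, id] at hv hmin
  refine ⟨v, ⟨hu, hv.1, hv.2, fun z hz hzv => ?_⟩, hmin w ⟨hw, h⟩⟩
  by_contra! hlt
  exact absurd (hmin z ⟨hz, hlt⟩) (by linarith)

theorem Neighbours.right_le {P : Finset ℝ} {u v w : ℝ} (h : Neighbours P u v) (hw : w ∈ P)
    (huw : u < w) : v ≤ w := by
  by_contra! hlt
  exact absurd (h.le_left w hw hlt) (by linarith)

namespace IsCFreeCycle

variable {f : ℝ → ℝ} {c : ℝ} {P Q : Finset ℝ} {m M p q : ℝ}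

theorem map_mem (hP : IsCFreeCycle f c P) {u : ℝ} (hu : u ∈ P) : f u ∈ P := by
  rw [← hP.image_eq]
  exact Finset.mem_image_of_mem f hu

theorem iterate_mem (hP : IsCFreeCycle f c P) {u : ℝ} (hu : u ∈ P) (n : ℕ) : f^[n] u ∈ P := by
  induction n with
  | zero => exact hu
  | succ n ih => rw [iterate_succ_apply']; exact hP.map_mem ih

theorem exists_preimage (hP : IsCFreeCycle f c P) {u : ℝ} (hu : u ∈ P) : ∃ v ∈ P, f v = u := by
  rw [← hP.image_eq] at hu
  simpa using hu

theorem injOn (hP : IsCFreeCycle f c P) : Set.InjOn f P :=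
  Finset.card_image_iff.1 (by rw [hP.image_eq])

theorem map_ne (hP : IsCFreeCycle f c P) {u : ℝ} (hu : u ∈ P) : f u ≠ u := by
  intro h
  have hall : ∀ v ∈ P, v = u := by
    intro v hv
    obtain ⟨i, -, rfl⟩ := hP.trans u hu v hv
    exact iterate_fixed h i
  have := Finset.card_le_one.2 (fun a ha b hb => (hall a ha).trans (hall b hb).symm)
  have := hP.one_lt_card
  omega

theorem lt_or_gt (hP : IsCFreeCycle f c P) {u : ℝ} (hu : u ∈ P) : u < c ∨ c < u :=
  lt_or_gt_of_ne (hP.ne u hu)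

theorem exists_frame (hf : IsExpandingLorenz f c) (hP : IsCFreeCycle f c P) :
    ∃ m M p q, CycleFrame f c P m M p q := by
  have hne : P.Nonempty := Finset.card_pos.1 (by have := hP.one_lt_card; omega)
  obtain ⟨m, hm, hmin⟩ := Finset.exists_min_image P id hne
  obtain ⟨M, hM, hmax⟩ := Finset.exists_max_image P id hne
  simp only [id] at hmin hmax
  have hfM : f M < M := lt_of_le_of_ne (hmax _ (hP.map_mem hM)) (hP.map_ne hM)
  have hfm : m < f m := lt_of_le_of_ne (hmin _ (hP.map_mem hm)) (hP.map_ne hm).symm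
  obtain ⟨p, hp, hfp⟩ := hP.exists_preimage hM
  obtain ⟨q, hq, hfq⟩ := hP.exists_preimage hm
  have hpc : p < c := by
    refine (hP.lt_or_gt hp).resolve_right fun h => ?_
    have := (hf.le_iff_of_right (hP.le_one p hp) (hP.le_one M hM) h
      (h.trans_le (hmax p hp))).2 (hmax p hp)
    linarith
  have hqc : c < q := by
    refine (hP.lt_or_gt hq).resolve_left fun h => ?_
    have := (hf.le_iff_of_left (hP.nonneg m hm) (hP.nonneg q hq)
      ((hmin q hq).trans_lt h) h).2 (hmin q hq)
    linarith
  refine ⟨m, M, p, q, hm, hM, hp, hq, hmin, hmax, hpc, hqc, fun u hu huc => ?_,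
    fun u hu huc => ?_, hfp, hfq⟩
  · rw [← hf.le_iff_of_left (hP.nonneg u hu) (hP.nonneg p hp) huc hpc, hfp]
    exact hmax _ (hP.map_mem hu)
  · rw [← hf.le_iff_of_right (hP.le_one q hq) (hP.le_one u hu) hqc huc, hfq]
    exact hmin _ (hP.map_mem hu)

theorem exists_covering (hP : IsCFreeCycle f c P)
    (fr : CycleFrame f c P m M p q) (hov : f m ≤ f M) {u v : ℝ} (h : Neighbours P u v) :
    ∃ u' v', Neighbours P u' v' ∧ (v' < c ∨ c < u') ∧ f u' ≤ u ∧ v ≤ f v' := by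
  have huM : u < M := h.lt.trans_le (fr.le_M v h.right_mem)
  have hmc : m < c := (fr.m_le p fr.p_mem).trans_lt fr.p_lt
  have hMc : c < M := fr.lt_q.trans_le (fr.le_M q fr.q_mem)
  rcases le_or_gt (f m) u with hu | hu
  · obtain ⟨u', hu', hmax⟩ := Finset.exists_max_image (P.filter (fun w => w < c ∧ f w ≤ u)) id
      ⟨m, by simp [fr.m_mem, hmc, hu]⟩
    simp only [Finset.mem_filter, id] at hu' hmax
    have hlt : u' < p := by
      refine lt_of_le_of_ne (fr.le_p u' hu'.1 hu'.2.1) ?_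
      rintro rfl
      linarith [hu'.2.2, fr.f_p]
    obtain ⟨v', hv', hle⟩ := exists_neighbour hu'.1 fr.p_mem hlt
    have hv'c : v' < c := hle.trans_lt fr.p_lt
    refine ⟨u', v', hv', Or.inl hv'c, hu'.2.2, h.right_le (hP.map_mem hv'.right_mem) ?_⟩
    by_contra! hcon
    exact absurd (hmax v' ⟨hv'.right_mem, hv'c, hcon⟩) (by linarith [hv'.lt])
  · have hvM : v ≤ f M := (h.right_le (hP.map_mem fr.m_mem) hu).trans hov
    obtain ⟨u', hu', hmax⟩ := Finset.exists_max_image (P.filter (fun w => c < w ∧ f w ≤ u)) id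
      ⟨q, by simp [fr.q_mem, fr.lt_q, fr.f_q, fr.m_le u h.left_mem]⟩
    simp only [Finset.mem_filter, id] at hu' hmax
    have hlt : u' < M := by
      refine lt_of_le_of_ne (fr.le_M u' hu'.1) ?_
      rintro rfl
      linarith [hu'.2.2, h.lt]
    obtain ⟨v', hv', hle⟩ := exists_neighbour hu'.1 fr.M_mem hlt
    refine ⟨u', v', hv', Or.inr hu'.2.1, hu'.2.2, h.right_le (hP.map_mem hv'.right_mem) ?_⟩
    by_contra! hcon
    exact absurd (hmax v' ⟨hv'.right_mem, hu'.2.1.trans hv'.lt, hcon⟩) (by linarith [hv'.lt])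

/-- On a cycle of minimal period, `f` preserves the cyclic order. -/
theorem map_max_lt_map_min (hf : IsExpandingLorenz f c) (hP : IsCFreeCycle f c P)
    (fr : CycleFrame f c P m M p q)
    (hmin : ∀ p : ℕ, 0 < p → p < P.card → ∀ x : ℝ, ¬ IsCFreePeriodic f c x p) :
    f M < f m := by
  by_contra! hov
  have hstep : ∀ g : {g : ℝ × ℝ // Neighbours P g.1 g.2}, ∃ g' : {g : ℝ × ℝ //
      Neighbours P g.1 g.2}, (g'.1.2 < c ∨ c < g'.1.1) ∧ f g'.1.1 ≤ g.1.1 ∧ g.1.2 ≤ f g'.1.2 := by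
    rintro ⟨⟨u, v⟩, h⟩
    obtain ⟨u', v', h', hh⟩ := hP.exists_covering fr hov h
    exact ⟨⟨⟨u', v'⟩, h'⟩, hh⟩
  choose B hB using hstep
  have hmM : m < M :=
    ((fr.m_le p fr.p_mem).trans_lt fr.p_lt).trans (fr.lt_q.trans_le (fr.le_M q fr.q_mem))
  obtain ⟨v, hv, -⟩ := exists_neighbour fr.m_mem fr.M_mem hmM
  set g : ℕ → {g : ℝ × ℝ // Neighbours P g.1 g.2} := fun t => B^[t] ⟨(m, v), hv⟩ with hg
  have hgs : ∀ t, g (t + 1) = B (g t) := fun t => iterate_succ_apply' _ _ _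
  have hcard := hP.one_lt_card
  obtain ⟨a, ha, b, hb, hab, heq⟩ := Finset.exists_ne_map_eq_of_card_lt_of_maps_to
    (s := Finset.range P.card) (t := P.erase M) (f := fun t => (g t).1.1)
    (by rw [Finset.card_erase_of_mem fr.M_mem, Finset.card_range]; omega)
    (by
      intro t _
      have := (g t).2
      simp only [Finset.coe_erase, Set.mem_sdiff, Finset.mem_coe, mem_singleton_iff]
      exact ⟨this.left_mem, (this.lt.trans_le (fr.le_M _ this.right_mem)).ne⟩)
  wlog hlt : a < b generalizing a b
  · exact this b hb a ha hab.symm heq.symm (by omega)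
  simp only [Finset.mem_range] at ha hb
  have heq2 : (g a).1.2 = (g b).1.2 := by
    have h1 := (g a).2
    have h2 := (g b).2
    exact le_antisymm (h1.right_le h2.right_mem (by rw [heq]; exact h2.lt))
      (h2.right_le h1.right_mem (by rw [← heq]; exact h1.lt))
  have hidx : ∀ t < b - a, g (b - t) = B (g (b - (t + 1))) := by
    intro t ht
    rw [← hgs, show b - (t + 1) + 1 = b - t by omega]
  obtain ⟨r, hr, hrle, z, hz⟩ := hf.exists_cFreePeriodic_of_loop
    (a := fun t => (g (b - t)).1.1) (b := fun t => (g (b - t)).1.2) (m := b - a) (by omega)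
    (by
      intro t ht
      have h1 := (g (b - t)).2
      have h2 := (hB (g (b - (t + 1)))).1
      rw [← hidx t ht] at h2
      exact h2.imp (fun h => ⟨hP.nonneg _ h1.left_mem, h⟩)
        (fun h => ⟨h, hP.le_one _ h1.right_mem⟩))
    (fun t _ => (g (b - t)).2.lt.le)
    (by
      intro t ht
      have h2 := (hB (g (b - (t + 1)))).2.1
      rwa [← hidx t ht] at h2)
    (by
      intro t ht
      have h2 := (hB (g (b - (t + 1)))).2.2
      rwa [← hidx t ht] at h2)
    (by simp only [Nat.sub_zero, show b - (b - a) = a by omega]; exact heq.le)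
    (by simp only [Nat.sub_zero, show b - (b - a) = a by omega]; exact heq2.ge)
  exact hmin r hr (by omega) z hz

theorem neighbours_map (hf : IsExpandingLorenz f c) (hP : IsCFreeCycle f c P)
    (fr : CycleFrame f c P m M p q) (hrot : f M < f m) {u v : ℝ} (h : Neighbours P u v)
    (hup : u ≠ p) : (v < c ∨ c < u) ∧ Neighbours P (f u) (f v) := by
  have hu0 := hP.nonneg u h.left_mem
  have hv1 := hP.le_one v h.right_mem
  have hu1 := hP.le_one u h.left_mem
  have hv0 := hP.nonneg v h.right_mem
  have hmc : m < c := (fr.m_le p fr.p_mem).trans_lt fr.p_lt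
  have hMc : c < M := fr.lt_q.trans_le (fr.le_M q fr.q_mem)
  have hm0 := hP.nonneg m fr.m_mem
  have hM1 := hP.le_one M fr.M_mem
  have hside : v < c ∨ c < u := by
    by_contra! hcon
    have huc : u < c := lt_of_le_of_ne hcon.2 (hP.ne u h.left_mem)
    have hvc : c < v := lt_of_le_of_ne hcon.1 (hP.ne v h.right_mem).symm
    exact hup (le_antisymm (fr.le_p u h.left_mem huc)
      (h.le_left p fr.p_mem (fr.p_lt.trans hvc)))
  refine ⟨hside, hP.map_mem h.left_mem, hP.map_mem h.right_mem, ?_, ?_⟩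
  · rcases hside with hs | hs
    · exact (hf.lt_iff_of_left hu0 hv0 (h.lt.trans hs) hs).2 h.lt
    · exact (hf.lt_iff_of_right hu1 hv1 hs (hs.trans h.lt)).2 h.lt
  · intro w hw hwv
    obtain ⟨w, hwP, rfl⟩ := hP.exists_preimage hw
    replace hw := hwP
    have hw0 := hP.nonneg w hw
    have hw1 := hP.le_one w hw
    rcases hside with hs | hs
    · rcases hP.lt_or_gt hw with hwc | hwc
      · rw [hf.lt_iff_of_left hw0 hv0 hwc hs] at hwv
        rw [hf.le_iff_of_left hw0 hu0 hwc (h.lt.trans hs)]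
        exact h.le_left w hw hwv
      · have h1 := (hf.le_iff_of_right hw1 hM1 hwc hMc).2 (fr.le_M w hw)
        have h2 := (hf.le_iff_of_left hm0 hu0 hmc (h.lt.trans hs)).2 (fr.m_le u h.left_mem)
        linarith
    · rcases hP.lt_or_gt hw with hwc | hwc
      · have h1 := (hf.le_iff_of_right hv1 hM1 (hs.trans h.lt) hMc).2 (fr.le_M v h.right_mem)
        have h2 := (hf.le_iff_of_left hm0 hw0 hmc hwc).2 (fr.m_le w hw)
        linarith
      · rw [hf.lt_iff_of_right hw1 hv1 hwc (hs.trans h.lt)] at hwv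
        rw [hf.le_iff_of_right hw1 hu1 hwc hs]
        exact h.le_left w hw hwv

theorem card_filter_lt_map (hP : IsCFreeCycle f c P) (y : ℝ) :
    (P.filter (· < f y)).card = (P.filter (fun u => f u < f y)).card := by
  conv_lhs => rw [← hP.image_eq, Finset.filter_image]
  exact Finset.card_image_of_injOn (hP.injOn.mono fun u hu => (Finset.mem_filter.1 hu).1)

theorem card_left_add_card_right (hP : IsCFreeCycle f c P) :
    (P.filter (· < c)).card + (P.filter (c < ·)).card = P.card := by
  rw [← Finset.card_filter_add_card_filter_not (s := P) (· < c)]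
  congr 2
  refine Finset.filter_congr fun u hu => ?_
  rw [not_lt]
  exact ⟨le_of_lt, fun h => lt_of_le_of_ne h (hP.ne u hu).symm⟩

theorem card_lt_map_of_left (hf : IsExpandingLorenz f c) (hP : IsCFreeCycle f c P)
    (fr : CycleFrame f c P m M p q) (hrot : f M < f m) {y : ℝ} (hmy : m ≤ y) (hyc : y < c) :
    (P.filter (· < f y)).card = (P.filter (· < y)).card + (P.filter (c < ·)).card := by
  have hm0 := hP.nonneg m fr.m_mem
  have hM1 := hP.le_one M fr.M_mem
  have hMc : c < M := fr.lt_q.trans_le (fr.le_M q fr.q_mem)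
  rw [hP.card_filter_lt_map, ← Finset.card_union_of_disjoint, ← Finset.filter_or]
  · congr 1
    refine Finset.filter_congr fun u hu => ?_
    rcases hP.lt_or_gt hu with huc | huc
    · rw [hf.lt_iff_of_left (hP.nonneg u hu) (hm0.trans hmy) huc hyc]
      exact ⟨Or.inl, fun h => h.resolve_right huc.not_gt⟩
    · have h1 := (hf.le_iff_of_right (hP.le_one u hu) hM1 huc hMc).2 (fr.le_M u hu)
      have h2 := (hf.le_iff_of_left hm0 (hm0.trans hmy) (hmy.trans_lt hyc) hyc).2 hmy
      exact ⟨fun _ => Or.inr huc, fun _ => by linarith⟩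
  · rw [Finset.disjoint_filter]
    intro u _ h1 h2
    linarith

theorem card_lt_map_of_right (hf : IsExpandingLorenz f c) (hP : IsCFreeCycle f c P)
    (fr : CycleFrame f c P m M p q) (hrot : f M < f m) {y : ℝ} (hyM : y ≤ M) (hyc : c < y) :
    (P.filter (· < f y)).card + (P.filter (· < c)).card = (P.filter (· < y)).card := by
  have hm0 := hP.nonneg m fr.m_mem
  have hM1 := hP.le_one M fr.M_mem
  have hmc : m < c := (fr.m_le p fr.p_mem).trans_lt fr.p_lt
  have h2 := (hf.le_iff_of_right (hyM.trans hM1) hM1 hyc (hyc.trans_le hyM)).2 hyM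
  have h1 : ∀ u ∈ P, u < c → f m ≤ f u := fun u hu huc =>
    (hf.le_iff_of_left hm0 (hP.nonneg u hu) hmc huc).2 (fr.m_le u hu)
  rw [hP.card_filter_lt_map, ← Finset.card_union_of_disjoint, ← Finset.filter_or]
  · congr 1
    refine Finset.filter_congr fun u hu => ?_
    rcases hP.lt_or_gt hu with huc | huc
    · exact ⟨fun _ => huc.trans hyc, fun _ => Or.inr huc⟩
    · rw [hf.lt_iff_of_right (hP.le_one u hu) (hyM.trans hM1) huc hyc]
      exact ⟨fun h => h.resolve_right huc.not_gt, Or.inl⟩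
  · rw [Finset.disjoint_filter]
    intro u hu h3 h4
    linarith [h1 u hu h4]

theorem card_lt_map_add_le (hf : IsExpandingLorenz f c) (hP : IsCFreeCycle f c P)
    (fr : CycleFrame f c P m M p q) (hrot : f M < f m) {y : ℝ} (hy0 : 0 ≤ y)
    (hyc : y ≠ c) (hy : M < y → ∀ u ∈ P, u < c → f u < f y → u = m) :
    (P.filter (· < f y)).card + P.card * (if c < y then 1 else 0) ≤
      (P.filter (· < y)).card + (P.filter (c < ·)).card + (if M < y then 1 else 0) := by
  have hMc : c < M := fr.lt_q.trans_le (fr.le_M q fr.q_mem)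
  have hlr := hP.card_left_add_card_right
  rcases lt_or_gt_of_ne hyc with hlt | hgt
  · rw [if_neg hlt.not_gt, if_neg (hlt.trans hMc).not_gt]
    rcases le_or_gt m y with hmy | hmy
    · rw [hP.card_lt_map_of_left hf fr hrot hmy hlt]
      omega
    · have : (P.filter (· < f y)).card ≤ (P.filter (c < ·)).card := by
        rw [hP.card_filter_lt_map]
        refine Finset.card_le_card (Finset.monotone_filter_right P fun u hu h => ?_)
        refine (hP.lt_or_gt hu).resolve_left fun huc => ?_
        rw [hf.lt_iff_of_left (hP.nonneg u hu) hy0 huc hlt] at h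
        linarith [fr.m_le u hu]
      omega
  · rw [if_pos hgt]
    rcases le_or_gt y M with hyM | hyM
    · have := hP.card_lt_map_of_right hf fr hrot hyM hgt
      rw [if_neg hyM.not_gt]
      omega
    · rw [if_pos hyM]
      have h1 : (P.filter (· < y)).card = P.card := by
        rw [Finset.filter_true_of_mem fun u hu => (fr.le_M u hu).trans_lt hyM]
      have h2 : (P.filter (· < f y)).card ≤ (P.filter (c < ·)).card + 1 := by
        rw [hP.card_filter_lt_map]
        refine (Finset.card_le_card (t := insert m (P.filter (c < ·))) fun u hu => ?_).trans
          (Finset.card_insert_le _ _)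
        simp only [Finset.mem_filter, Finset.mem_insert] at hu ⊢
        rcases hP.lt_or_gt hu.1 with huc | huc
        · exact Or.inl (hy hyM u hu.1 huc hu.2)
        · exact Or.inr ⟨hu.1, huc⟩
      omega

theorem eq_min_of_map_lt (hf : IsExpandingLorenz f c) (hP : IsCFreeCycle f c P)
    (hQ : IsCFreeCycle f c Q) (fr : CycleFrame f c P m M p q) {m' M' p' q' : ℝ}
    (fr' : CycleFrame f c Q m' M' p' q') (hrot : f M < f m)
    (hmin : ∀ p : ℕ, 0 < p → p < P.card → ∀ x : ℝ, ¬ IsCFreePeriodic f c x p)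
    {y : ℝ} (hy : y ∈ Q) (hMy : M < y) {u : ℝ} (hu : u ∈ P) (huc : u < c) (huy : f u < f y) :
    u = m := by
  by_contra hum
  have hMc : c < M := fr.lt_q.trans_le (fr.le_M q fr.q_mem)
  have hMM' : M < M' := hMy.trans_le (fr'.le_M y hy)
  have hM'1 := hQ.le_one M' fr'.M_mem
  obtain ⟨w, hw, hwu⟩ := exists_neighbour fr.m_mem hu (lt_of_le_of_ne (fr.m_le u hu) (Ne.symm hum))
  have hwc : w < c := hwu.trans_lt huc
  have hfw : f w ≤ f M' := by
    have h1 := (hf.le_iff_of_left (hP.nonneg w hw.right_mem) (hP.nonneg u hu) hwc huc).2 hwu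
    have h2 := (hf.le_iff_of_right (hQ.le_one y hy) hM'1 (hMc.trans hMy)
      (hMc.trans hMM')).2 (fr'.le_M y hy)
    linarith
  have hpp' : p < p' := by
    rw [← hf.lt_iff_of_left (hP.nonneg p fr.p_mem) (hQ.nonneg p' fr'.p_mem) fr.p_lt fr'.p_lt,
      fr.f_p, fr'.f_p]
    exact hMM'
  have hmp : m ≠ p := (hw.lt.trans_le (fr.le_p w hw.right_mem hwc)).ne
  obtain ⟨i, hi, hip⟩ := hP.trans q fr.q_mem p fr.p_mem
  have hex : ∃ i, f^[i] m = p ∧ i + 1 < P.card := by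
    cases i with
    | zero => exact absurd hip (fr.p_lt.trans fr.lt_q).ne'
    | succ i => exact ⟨i, by rwa [iterate_succ_apply, fr.f_q] at hip, hi⟩
  obtain ⟨hk, hkcard⟩ := Nat.find_spec hex
  have hkmin : ∀ t < Nat.find hex, f^[t] m ≠ p := fun t ht h =>
    Nat.find_min hex ht ⟨h, by omega⟩
  generalize Nat.find hex = k at hk hkcard hkmin
  have hnb : ∀ t ≤ k, Neighbours P (f^[t] m) (f^[t] w) := by
    intro t
    induction t with
    | zero => exact fun _ => hw
    | succ t ih =>
      intro ht
      rw [iterate_succ_apply', iterate_succ_apply']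
      exact (hP.neighbours_map hf fr hrot (ih (by omega)) (hkmin t (by omega))).2
  cases k with
  | zero => exact hmp hk
  | succ k =>
  let a : ℕ → ℝ := fun t => match t with
    | 0 => p
    | 1 => M
    | t + 2 => f^[t + 1] m
  let b : ℕ → ℝ := fun t => match t with
    | 0 => p'
    | 1 => M'
    | t + 2 => f^[t + 1] w
  have hlast := hnb (k + 1) le_rfl
  obtain ⟨r, hr, hrle, z, hz⟩ := hf.exists_cFreePeriodic_of_loop (a := a) (b := b) (m := k + 2)
    (by omega)
    (by
      rintro (_ | _ | t) ht
      · exact Or.inl ⟨hP.nonneg p fr.p_mem, fr'.p_lt⟩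
      · exact Or.inr ⟨hMc, hM'1⟩
      · have h1 := hnb (t + 1) (by omega)
        exact (hP.neighbours_map hf fr hrot h1 (hkmin _ (by omega))).1.imp
          (fun h => ⟨hP.nonneg _ h1.left_mem, h⟩) (fun h => ⟨h, hP.le_one _ h1.right_mem⟩))
    (by
      rintro (_ | _ | t) ht
      · exact hpp'.le
      · exact hMM'.le
      · exact (hnb (t + 1) (by omega)).lt.le)
    (by
      rintro (_ | _ | t) ht
      · exact fr.f_p.le
      · exact hrot.le
      · exact (iterate_succ_apply' f (t + 1) m).ge)
    (by
      rintro (_ | _ | t) ht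
      · exact fr'.f_p.ge
      · exact hfw
      · exact (iterate_succ_apply' f (t + 1) w).le)
    hk.le
    (by
      change p' ≤ f^[k + 1] w
      rw [hk] at hlast
      refine fr'.p_lt.le.trans (le_of_not_gt fun h => ?_)
      exact absurd (fr.le_p _ hlast.right_mem h) hlast.lt.not_ge)
  exact hmin r hr (by omega) z hz

theorem card_right_le (hf : IsExpandingLorenz f c) (hP : IsCFreeCycle f c P)
    (hQ : IsCFreeCycle f c Q) (hPQ : P.card = Q.card)
    (hmin : ∀ p : ℕ, 0 < p → p < P.card → ∀ x : ℝ, ¬ IsCFreePeriodic f c x p) :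
    (Q.filter (c < ·)).card ≤ (P.filter (c < ·)).card := by
  obtain ⟨m, M, p, q, fr⟩ := hP.exists_frame hf
  obtain ⟨m', M', p', q', fr'⟩ := hQ.exists_frame hf
  have hrot := hP.map_max_lt_map_min hf fr hmin
  have hMc : c < M := fr.lt_q.trans_le (fr.le_M q fr.q_mem)
  have hsum := Finset.sum_le_sum fun y (hy : y ∈ Q) =>
    hP.card_lt_map_add_le hf fr hrot (hQ.nonneg y hy) (hQ.ne y hy)
      (fun hMy _ hu huc huy => hP.eq_min_of_map_lt hf hQ fr fr' hrot hmin hy hMy hu huc huy)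
  have hinv : ∑ y ∈ Q, (P.filter (· < f y)).card = ∑ y ∈ Q, (P.filter (· < y)).card := by
    conv_rhs => rw [← hQ.image_eq, Finset.sum_image hQ.injOn]
  simp only [Finset.sum_add_distrib, ← Finset.mul_sum, ← Finset.card_filter, Finset.sum_const,
    smul_eq_mul] at hsum
  rw [hinv, ← hPQ] at hsum
  have hlt : (Q.filter (M < ·)).card < P.card := by
    rw [hPQ]
    refine Finset.card_lt_card (Finset.filter_ssubset.2 ⟨p', fr'.p_mem, ?_⟩)
    linarith [fr'.p_lt]
  by_contra! hcon
  nlinarith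

theorem card_lt_lt_card_left_iff (hP : IsCFreeCycle f c P) {u : ℝ} (hu : u ∈ P) :
    (P.filter (· < u)).card < (P.filter (· < c)).card ↔ u < c := by
  constructor
  · intro h
    refine (hP.lt_or_gt hu).resolve_right fun huc => h.not_ge (Finset.card_le_card ?_)
    exact Finset.monotone_filter_right P fun v _ hv => lt_trans hv huc
  · intro huc
    refine Finset.card_lt_card (Finset.ssubset_iff_subset_ne.2
      ⟨Finset.monotone_filter_right P fun v _ hv => lt_trans hv huc, fun h => ?_⟩)
    have : u ∈ P.filter (· < c) := by simp [hu, huc]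
    rw [← h] at this
    simp at this

theorem exists_mem_inter (hf : IsExpandingLorenz f c) (hP : IsCFreeCycle f c P)
    (hQ : IsCFreeCycle f c Q) (hPQ : P.card = Q.card)
    (hmin : ∀ p : ℕ, 0 < p → p < P.card → ∀ x : ℝ, ¬ IsCFreePeriodic f c x p) :
    ∃ u, u ∈ P ∧ u ∈ Q := by
  have hright := le_antisymm (hQ.card_right_le hf hP hPQ.symm (hPQ ▸ hmin))
    (hP.card_right_le hf hQ hPQ hmin)
  obtain ⟨m, M, p, q, fr⟩ := hP.exists_frame hf
  obtain ⟨m', M', p', q', fr'⟩ := hQ.exists_frame hf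
  have hrot := hP.map_max_lt_map_min hf fr hmin
  have hrot' := hQ.map_max_lt_map_min hf fr' (hPQ ▸ hmin)
  have hleft : (P.filter (· < c)).card = (Q.filter (· < c)).card := by
    have := hP.card_left_add_card_right
    have := hQ.card_left_add_card_right
    omega
  have hside : ∀ u ∈ P, ∀ v ∈ Q, (P.filter (· < u)).card = (Q.filter (· < v)).card →
      (u < c ↔ v < c) := by
    intro u hu v hv h
    rw [← hP.card_lt_lt_card_left_iff hu, ← hQ.card_lt_lt_card_left_iff hv, h, hleft]
  have hrank : ∀ n, (P.filter (· < f^[n] m)).card = (Q.filter (· < f^[n] m')).card := by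
    intro n
    induction n with
    | zero =>
      exact (Finset.card_eq_zero.2 (Finset.filter_eq_empty_iff.2
        fun u hu => (fr.m_le u hu).not_gt)).trans (Finset.card_eq_zero.2
          (Finset.filter_eq_empty_iff.2 fun u hu => (fr'.m_le u hu).not_gt)).symm
    | succ n ih =>
      rw [iterate_succ_apply', iterate_succ_apply']
      have h1 := hP.iterate_mem fr.m_mem n
      have h2 := hQ.iterate_mem fr'.m_mem n
      have hs := hside _ h1 _ h2 ih
      rcases hP.lt_or_gt h1 with hlt | hgt
      · rw [hP.card_lt_map_of_left hf fr hrot (fr.m_le _ h1) hlt,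
          hQ.card_lt_map_of_left hf fr' hrot' (fr'.m_le _ h2) (hs.1 hlt), ih, hright]
      · have hgt' := (hQ.lt_or_gt h2).resolve_left fun h => (hs.2 h).not_gt hgt
        have e1 := hP.card_lt_map_of_right hf fr hrot (fr.le_M _ h1) hgt
        have e2 := hQ.card_lt_map_of_right hf fr' hrot' (fr'.le_M _ h2) hgt'
        omega
  have heq : m = m' := by
    refine hf.eq_of_sameBranch_iterate fun n => ?_
    have h1 := hP.iterate_mem fr.m_mem n
    have h2 := hQ.iterate_mem fr'.m_mem n
    have hs := hside _ h1 _ h2 (hrank n)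
    rcases hP.lt_or_gt h1 with hlt | hgt
    · exact Or.inl ⟨hP.nonneg _ h1, hlt, hQ.nonneg _ h2, hs.1 hlt⟩
    · have hgt' := (hQ.lt_or_gt h2).resolve_left fun h => (hs.2 h).not_gt hgt
      exact Or.inr ⟨hgt, hP.le_one _ h1, hgt', hQ.le_one _ h2⟩
  exact ⟨m, fr.m_mem, heq ▸ fr'.m_mem⟩

end IsCFreeCycle

/-- if `f` has no `c`-free periodic point of period `< κ`, then it has at
most one `c`-free periodic orbit of period `κ`. -/
theorem unique_minimal_period_orbit
    (f : ℝ → ℝ) (c : ℝ) (κ : ℕ) (hf : IsExpandingLorenz f c) (hκ : 1 < κ)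
    (hmin : ∀ p : ℕ, 0 < p → p < κ → ∀ x : ℝ, ¬ IsCFreePeriodic f c x p) :
    ∀ x y : ℝ, IsCFreePeriodic f c x κ → IsCFreePeriodic f c y κ →
      ∃ i < κ, f^[i] x = y := by
  intro x y hx hy
  obtain ⟨hP, hPc⟩ := hx.isCFreeCycle hf hκ
  obtain ⟨hQ, hQc⟩ := hy.isCFreeCycle hf hκ
  obtain ⟨u, huP, huQ⟩ := hP.exists_mem_inter hf hQ (hPc.trans hQc.symm) (by rwa [hPc])
  have hxP : x ∈ (Finset.range κ).image (fun i => f^[i] x) :=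
    Finset.mem_image.2 ⟨0, by simp; omega, rfl⟩
  have hyQ : y ∈ (Finset.range κ).image (fun i => f^[i] y) :=
    Finset.mem_image.2 ⟨0, by simp; omega, rfl⟩
  obtain ⟨i, -, hi⟩ := hQ.trans u huQ y hyQ
  have hyP := hP.iterate_mem huP i
  rw [hi] at hyP
  obtain ⟨k, hk, hky⟩ := hP.trans x hxP y hyP
  exact ⟨k, hPc ▸ hk, hky⟩
end
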